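/- arXiv:2601.12457 — 2 statements merged into one kernel-verified Lean document; each statement's English description precedes it below -/
import Mathlib

section
/- Let p be a prime, let P ⊆ 𝔽_p be nonempty with |P| = κ·p, and let ε ∈ (0,1). Then there exists a set X ⊆ 𝔽_p such that: (i) 𝔽_p = ⋃_{x∈X} ( x + (P −_{εκ²} P) ); (ii) |X| ≤ 1/(κ·(1−ε)); (iii) for all distinct x, x′ ∈ X one has |(x + P) ∩ (x′ + P)| ≤ ε·κ²·p. -/
open scoped Pointwise

/-- The number of representations `x = a - b` with `a ∈ A`, `b ∈ B`. -/
def rdiff {α : Type*} [DecidableEq α] [Sub α] (A B : Finset α) (x : α) : ℕ :=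
  ((A ×ˢ B).filter (fun ab => ab.1 - ab.2 = x)).card

/-- The popular difference set `A -_ε B = {x : r_{A-B}(x) ≥ ε p}`. -/
noncomputable def popDiff {p : ℕ} [NeZero p] (A B : Finset (ZMod p)) (ε : ℝ) :
    Finset (ZMod p) :=
  Finset.univ.filter (fun x => ε * (p : ℝ) ≤ (rdiff A B x : ℝ))

theorem sq_sum_card_le_card_mul_sum_card_inter {ι α : Type*} [Fintype α] [DecidableEq α]
    (s : Finset ι) (S : ι → Finset α) :
    (∑ i ∈ s, ((S i).card : ℝ)) ^ 2 ≤
      Fintype.card α * ∑ i ∈ s, ∑ j ∈ s, ((S i ∩ S j).card : ℝ) := by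
  let f : ι → α → ℝ := fun i z => if z ∈ S i then 1 else 0
  have h₁ : ∑ i ∈ s, ((S i).card : ℝ) = ∑ z, ∑ i ∈ s, f i z := by
    rw [Finset.sum_comm]
    exact Finset.sum_congr rfl fun i _ => by simp [f]
  have h₂ : ∑ i ∈ s, ∑ j ∈ s, ((S i ∩ S j).card : ℝ) = ∑ z, (∑ i ∈ s, f i z) ^ 2 := by
    have h₃ (i j : ι) : ((S i ∩ S j).card : ℝ) = ∑ z, f i z * f j z := by
      simp [f, ← ite_and, Finset.inter_comm, ← Finset.mem_inter]
    simp_rw [h₃, sq, Finset.sum_mul_sum]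
    exact (Finset.sum_congr rfl fun i _ => Finset.sum_comm).trans Finset.sum_comm
  rw [h₁, h₂]
  exact sq_sum_le_card_mul_sum_sq

theorem rdiff_sub_eq_card_inter {α : Type*} [DecidableEq α] [AddCommGroup α]
    (P : Finset α) (x y : α) :
    rdiff P P (y - x) = (({x} + P) ∩ ({y} + P)).card := by
  refine Finset.card_bij' (fun ab _ => x + ab.1) (fun z _ => (z - x, z - y)) ?_ ?_ ?_ ?_
  · rintro ⟨a, b⟩ h
    simp only [Finset.mem_filter, Finset.mem_product] at h
    simp only [Finset.singleton_add, Finset.mem_inter, Finset.mem_vadd_finset, vadd_eq_add]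
    refine ⟨⟨a, h.1.1, rfl⟩, b, h.1.2, ?_⟩
    rw [eq_add_of_sub_eq h.2]
    abel
  · intro z h
    simp only [Finset.singleton_add, Finset.mem_inter, Finset.mem_vadd_finset, vadd_eq_add] at h
    obtain ⟨⟨a, ha, rfl⟩, b, hb, hab⟩ := h
    simp only [Finset.mem_filter, Finset.mem_product]
    refine ⟨⟨by simpa using ha, ?_⟩, by abel⟩
    rw [← hab]
    simpa using hb
  · rintro ⟨a, b⟩ h
    simp only [Finset.mem_filter, Finset.mem_product] at h
    rw [eq_add_of_sub_eq h.2]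
    ext <;> simp only <;> abel
  · intro z _
    simp

/-- Covering of `𝔽_p` by translates of a popular difference set. -/
theorem popular_covering (p : ℕ) [Fact p.Prime] (P : Finset (ZMod p)) (hP : P.Nonempty)
    (κ ε : ℝ) (hκ : (P.card : ℝ) = κ * (p : ℝ)) (hε0 : 0 < ε) (hε1 : ε < 1) :
    ∃ X : Finset (ZMod p),
      X + popDiff P P (ε * κ ^ 2) = (Finset.univ : Finset (ZMod p)) ∧
      (X.card : ℝ) ≤ 1 / (κ * (1 - ε)) ∧
      ∀ x ∈ X, ∀ x' ∈ X, x ≠ x' →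
        ((({x} + P) ∩ ({x'} + P)).card : ℝ) ≤ ε * κ ^ 2 * (p : ℝ) := by
  have hp : (0 : ℝ) < p := by exact_mod_cast (Fact.out : p.Prime).pos
  have hκ0 : 0 < κ := by
    have : (0 : ℝ) < P.card := by exact_mod_cast hP.card_pos
    exact pos_of_mul_pos_left (hκ ▸ this) hp.le
  have hκ1 : κ ≤ 1 := by
    have : (P.card : ℝ) ≤ p := by
      exact_mod_cast P.card_le_univ.trans_eq (ZMod.card p)
    exact le_of_mul_le_mul_right (by linarith) hp
  have hdiag : ε * κ ^ 2 * p ≤ κ * p := by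
    refine mul_le_mul_of_nonneg_right ?_ hp.le
    nlinarith [mul_le_one₀ hε1.le hκ0.le hκ1]
  obtain ⟨X, hX, hmax⟩ := (Set.toFinite {X : Finset (ZMod p) | ∀ x ∈ X, ∀ x' ∈ X, x ≠ x' →
    ((({x} + P) ∩ ({x'} + P)).card : ℝ) ≤ ε * κ ^ 2 * (p : ℝ)}).exists_maximal ⟨∅, by simp⟩
  rw [Set.mem_ofPred_eq] at hX
  refine ⟨X, ?_, ?_, hX⟩
  · refine Finset.eq_univ_of_forall fun y => ?_
    obtain ⟨x, hx, hxy⟩ : ∃ x ∈ X, ε * κ ^ 2 * p ≤ ((({x} + P) ∩ ({y} + P)).card : ℝ) := by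
      by_contra! h
      have hy : y ∈ X := by
        refine hmax (y := insert y X) ?_ (Finset.subset_insert y X) (Finset.mem_insert_self y X)
        intro a ha b hb hab
        rcases Finset.mem_insert.1 ha with hay | ha <;>
          rcases Finset.mem_insert.1 hb with hby | hb
        · exact absurd (hay.trans hby.symm) hab
        · rw [hay, Finset.inter_comm]
          exact (h b hb).le
        · rw [hby]
          exact (h a ha).le
        · exact hX a ha b hb hab
      have := h y hy
      rw [Finset.inter_self, Finset.singleton_add, Finset.card_vadd_finset] at this
      linarith
    refine Finset.mem_add.2 ⟨x, hx, y - x, ?_, add_sub_cancel x y⟩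
    simpa [popDiff, rdiff_sub_eq_card_inter] using hxy
  · have hcs := sq_sum_card_le_card_mul_sum_card_inter X fun x => {x} + P
    have hrow : ∀ x ∈ X, ∑ x' ∈ X, ((({x} + P) ∩ ({x'} + P)).card : ℝ) ≤
        κ * p + X.card * (ε * κ ^ 2 * p) := by
      intro x hx
      rw [← Finset.add_sum_erase X _ hx]
      refine add_le_add ?_ ?_
      · simp [hκ]
      · refine (Finset.sum_le_card_nsmul _ _ (ε * κ ^ 2 * p) fun x' hx' => ?_).trans ?_
        · exact hX x hx x' (Finset.mem_of_mem_erase hx') (Finset.ne_of_mem_erase hx').symm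
        · rw [nsmul_eq_mul]
          gcongr
          exact Finset.erase_subset x X
    have hsum := Finset.sum_le_card_nsmul X _ _ hrow
    simp only [Finset.singleton_add, Finset.card_vadd_finset, Finset.sum_const, nsmul_eq_mul, hκ,
      ZMod.card] at hcs hsum
    rw [le_div_iff₀ (by nlinarith)]
    rcases X.card.eq_zero_or_pos with h0 | h0
    · simp [h0]
    have hn : (0 : ℝ) < X.card := by exact_mod_cast h0
    have hfin := hcs.trans (mul_le_mul_of_nonneg_left hsum hp.le)
    have hpos : 0 < (X.card : ℝ) * κ * p ^ 2 := by positivity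
    refine le_of_mul_le_mul_left ?_ hpos
    linarith
end

section
/- Let n ≥ 1 and let S_1, S_2, …, S_n be finite sets, and let k ≥ l be positive integers such that |S_i| ≥ k for all i and |S_i ∩ S_j| ≤ l for all i ≠ j. If n ≥ k/l, then |S_1 ∪ S_2 ∪ ⋯ ∪ S_n| ≥ k²/(2l). -/
/-- Bonferroni-type bound: a union of `c` sets of size at least `k` with pairwise intersections
of size at most `l` has at least `c * k - l * c * (c - 1) / 2` elements. -/
theorem two_mul_card_biUnion_ge {ι α : Type*} [DecidableEq ι] [DecidableEq α] {k l : ℕ}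
    {S : ι → Finset α} (hsize : ∀ i, k ≤ (S i).card)
    (hinter : ∀ i j, i ≠ j → (S i ∩ S j).card ≤ l) (s : Finset ι) :
    2 * (s.card * k) + l * s.card ≤ 2 * (s.biUnion S).card + l * s.card ^ 2 := by
  induction s using Finset.induction_on with
  | empty => simp
  | insert a s ha ih =>
    have hunion := Finset.card_union_add_card_inter (S a) (s.biUnion S)
    have hcap : (S a ∩ s.biUnion S).card ≤ s.card * l := by
      rw [Finset.inter_biUnion]
      exact Finset.card_biUnion_le_card_mul _ _ _ fun i hi =>
        hinter a i (ne_of_mem_of_not_mem hi ha).symm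
    rw [Finset.biUnion_insert, Finset.card_insert_of_notMem ha]
    nlinarith [hsize a]

/-- If additionally `n ≥ k / l`, the union has at least `k² / (2l)` elements. -/
theorem union_lower_bound_many {α : Type*} [DecidableEq α] (n k l : ℕ) (hn : 1 ≤ n)
    (hl : 0 < l) (hkl : l ≤ k) (S : Fin n → Finset α)
    (hsize : ∀ i, k ≤ (S i).card)
    (hinter : ∀ i j, i ≠ j → ((S i) ∩ (S j)).card ≤ l)
    (hmany : (k : ℝ) / (l : ℝ) ≤ (n : ℝ)) :
    (k : ℝ) ^ 2 / (2 * (l : ℝ)) ≤ ((Finset.univ.biUnion S).card : ℝ) := by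
  have hle : k / l ≤ n := by exact_mod_cast Nat.cast_div_le.trans hmany
  obtain ⟨s, -, hs⟩ := Finset.exists_subset_card_eq (s := (Finset.univ : Finset (Fin n)))
    (n := k / l) (by simpa using hle)
  have hbound := two_mul_card_biUnion_ge hsize hinter s
  have hmono : (s.biUnion S).card ≤ (Finset.univ.biUnion S).card :=
    Finset.card_le_card (Finset.biUnion_subset_biUnion_of_subset_left S (Finset.subset_univ s))
  have hpos : 1 ≤ k / l := Nat.div_pos hkl hl
  have hmod : k % l < l := Nat.mod_lt k hl
  have hdiv := Nat.div_add_mod k l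
  rw [hs] at hbound
  generalize k / l = m at *
  generalize k % l = r at *
  have hr : r ^ 2 ≤ l ^ 2 * m :=
    (Nat.pow_le_pow_left hmod.le 2).trans (Nat.le_mul_of_pos_right _ hpos)
  have hscaled := Nat.mul_le_mul_left l (hbound.trans (Nat.add_le_add_right
    (Nat.mul_le_mul_left 2 hmono) _))
  have hkey : k ^ 2 ≤ (Finset.univ.biUnion S).card * (2 * l) := by
    subst hdiv
    nlinarith
  rw [div_le_iff₀ (by positivity)]
  exact_mod_cast hkey
end
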